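/- arXiv:2012.06467 — 2 statements merged into one kernel-verified Lean document; each statement's English description precedes it below -/
import Mathlib

section
/- For every prime power q, every integer t ≥ 2, and every real ρ with 0 ≤ ρ ≤ 1, the minimal asymptotic rate of codes with normalized t-th generalized covering radius at most ρ satisfies κ_t(ρ,q) ≤ 1 − H_q(ρ/t). -/
noncomputable section

/-- The `t`-weight of a `t × n` matrix over `F`: the number of nonzero columns. -/
def twt {F : Type*} [Field F] {t n : ℕ} (v : Matrix (Fin t) (Fin n) F) : ℕ :=
  Set.ncard {j : Fin n | ∃ i : Fin t, v i j ≠ 0}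

/-- The `t`-ball of radius `r` centered at `v`. -/
def tBall {F : Type*} [Field F] {t n : ℕ} (r : ℕ) (v : Matrix (Fin t) (Fin n) F) :
    Set (Matrix (Fin t) (Fin n) F) :=
  {v' | twt (v' - v) ≤ r}

/-- The `t`-th generalized covering radius of a code `C ⊆ F^n`. -/
def genCovRad {F : Type*} [Field F] {n : ℕ} (C : Set (Fin n → F)) (t : ℕ) : ℕ :=
  sInf {r : ℕ | ∀ v : Matrix (Fin t) (Fin n) F,
    ∃ c : Matrix (Fin t) (Fin n) F, (∀ i, c i ∈ C) ∧ v ∈ tBall r c}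

/-- `kMin F t n r` is the smallest dimension of a linear code `C ⊆ F^n` with
`t`-th generalized covering radius at most `r`. -/
def kMin (F : Type*) [Field F] [Fintype F] (t n r : ℕ) : ℕ :=
  sInf { k : ℕ | ∃ C : Submodule F (Fin n → F), Module.finrank F C = k ∧
    genCovRad (C : Set (Fin n → F)) t ≤ r }

/-- `kappa F t ρ` is the asymptotic minimal rate of linear codes over `F` with normalized
`t`-th generalized covering radius at most `ρ`. -/
noncomputable def kappa (F : Type*) [Field F] [Fintype F] (t : ℕ) (ρ : ℝ) : ℝ :=
  Filter.liminf (fun n : ℕ => (kMin F t n ⌊ρ * n⌋₊ : ℝ) / n) Filter.atTop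

/-- The `q`-ary entropy function. -/
noncomputable def qEnt (q : ℕ) (x : ℝ) : ℝ :=
  x * Real.logb q (q - 1) - x * Real.logb q x - (1 - x) * Real.logb q (1 - x)

open Finset in
open Classical in
/-- points covered by translates of `B` by elements of `C` -/
def covSet {F V : Type*} [Field F] [AddCommGroup V] [Module F V] [Fintype V]
    (B : Finset V) (C : Submodule F V) : Finset V :=
  Finset.univ.filter (fun y => ∃ c ∈ C, y - c ∈ B)

theorem covSet_sup {F V : Type*} [Field F] [AddCommGroup V] [Module F V] [Fintype V]
    (B : Finset V) (C : Submodule F V) (x y : V) (a : F) (h : y - a • x ∈ covSet B C) :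
    y ∈ covSet B (C ⊔ Submodule.span F {x}) := by
  classical
  simp only [covSet, Finset.mem_filter, Finset.mem_univ, true_and] at h ⊢
  obtain ⟨c, hc, hb⟩ := h
  refine ⟨c + a • x, ?_, ?_⟩
  · exact Submodule.add_mem_sup hc (Submodule.smul_mem _ _ (Submodule.mem_span_singleton_self x))
  · rwa [show y - (c + a • x) = y - a • x - c by abel]

theorem sum_shift {V : Type*} [AddCommGroup V] [Fintype V] (f : V → ℝ) (z : V) :
    ∑ y, f (y - z) = ∑ y, f y :=
  Fintype.sum_equiv (Equiv.subRight z) _ _ (fun _ => rfl)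

theorem sum_pair {F V : Type*} [Field F] [AddCommGroup V] [Module F V] [Fintype V]
    (f : V → ℝ) (a b : F) (hab : a ≠ b) :
    ∑ x : V, ∑ y : V, f (y - a • x) * f (y - b • x) = (∑ y, f y) * (∑ y, f y) := by
  rw [Finset.sum_mul_sum, ← Fintype.sum_prod_type', ← Fintype.sum_prod_type']
  have hinj : Function.Injective (fun p : V × V => (p.2 - a • p.1, p.2 - b • p.1)) := by
    rintro ⟨x, y⟩ ⟨x', y'⟩ h
    simp only [Prod.mk.injEq] at h
    obtain ⟨h1, h2⟩ := h
    have h3 : (a - b) • (x - x') = 0 := by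
      have : (a - b) • (x - x') = (y' - a • x' - (y' - b • x')) - (y - a • x - (y - b • x)) := by
        rw [sub_smul, smul_sub, smul_sub]; abel
      rw [this, h1, h2]; abel
    have hx : x = x' := by
      rcases smul_eq_zero.1 h3 with h | h
      · exact absurd (sub_eq_zero.1 h) hab
      · exact sub_eq_zero.1 h
    subst hx
    simpa using h1
  exact Fintype.sum_bijective _ hinj.bijective_of_finite _ _ (fun _ => rfl)

open Classical in
theorem sum_ind {V : Type*} [Fintype V] (W : Finset V) :
    ∑ y, (if y ∈ W then (1 : ℝ) else 0) = W.card := by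
  simp

theorem step1 {F V : Type*} [Field F] [Fintype F] [AddCommGroup V] [Module F V] [Fintype V]
    (B : Finset V) (C : Submodule F V) :
    ∃ x : V, (Fintype.card F : ℝ) * (covSet B C).card * Fintype.card V ≤
      (covSet B (C ⊔ Submodule.span F {x})).card *
        (Fintype.card V + (Fintype.card F - 1) * (covSet B C).card) := by
  classical
  by_contra! hcon
  set W := covSet B C with hW
  set f : V → ℝ := fun y => if y ∈ W then 1 else 0 with hf
  set q : ℝ := (Fintype.card F : ℝ) with hq
  set N : ℝ := (Fintype.card V : ℝ) with hN
  set w : ℝ := (W.card : ℝ) with hw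
  have hq1 : 1 ≤ q := by
    rw [hq]; exact_mod_cast Fintype.card_pos
  have hN0 : 0 < N := by
    rw [hN]; exact_mod_cast Fintype.card_pos
  have hw0 : 0 ≤ w := Nat.cast_nonneg _
  have hD : 0 < N + (q - 1) * w := by
    have := mul_nonneg (sub_nonneg.2 hq1) hw0
    linarith
  set D := N + (q - 1) * w with hDd
  set X : V → V → ℝ := fun x y => ∑ a : F, f (y - a • x) with hX
  have hfs : ∑ y, f y = w := sum_ind W
  have hff : ∀ y, f y * f y = f y := by intro y; simp only [hf]; split_ifs <;> simp
  have e1 : ∑ x, ∑ y, X x y = q * N * w := by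
    simp only [hX]
    have : ∀ x : V, ∑ y, ∑ a : F, f (y - a • x) = q * w := by
      intro x
      rw [Finset.sum_comm]
      simp only [sum_shift, hfs]
      simp [hq]
    simp only [this]
    simp [hN]; ring
  have e2 : ∑ x, ∑ y, X x y ^ 2 = q * w * D := by
    have h1 : ∑ x, ∑ y, X x y ^ 2 =
        ∑ a : F, ∑ b : F, ∑ x : V, ∑ y : V, f (y - a • x) * f (y - b • x) := by
      simp only [hX, sq, Finset.sum_mul_sum]
      calc _ = ∑ x : V, ∑ a : F, ∑ b : F, ∑ y : V, f (y - a • x) * f (y - b • x) := by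
            refine Finset.sum_congr rfl fun x _ => ?_
            rw [Finset.sum_comm]
            refine Finset.sum_congr rfl fun a _ => ?_
            rw [Finset.sum_comm]
        _ = _ := by
            rw [Finset.sum_comm]
            refine Finset.sum_congr rfl fun a _ => ?_
            rw [Finset.sum_comm]
    rw [h1]
    have h2 : ∀ a b : F, ∑ x : V, ∑ y : V, f (y - a • x) * f (y - b • x) =
        w * w + if a = b then N * w - w * w else 0 := by
      intro a b
      split_ifs with hab
      · subst hab
        simp only [hff, sum_shift, hfs]
        simp [hN]
      · rw [sum_pair f a b hab, hfs]; ring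
    simp only [h2, Finset.sum_add_distrib, Finset.sum_ite_eq, Finset.mem_univ, if_true]
    simp only [Finset.sum_const, Finset.card_univ, nsmul_eq_mul]
    rw [← hq, hDd]; ring
  have key : ∀ x y, 2 * (N / D) * X x y - (N / D) ^ 2 * X x y ^ 2 ≤
      if y ∈ covSet B (C ⊔ Submodule.span F {x}) then (1 : ℝ) else 0 := by
    intro x y
    split_ifs with h
    · nlinarith [sq_nonneg (N / D * X x y - 1)]
    · have : X x y = 0 := by
        simp only [hX]
        refine Finset.sum_eq_zero fun a _ => ?_
        simp only [hf]
        rw [if_neg]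
        intro h'
        exact h (covSet_sup B C x y a h')
      rw [this]; simp
  have hsum := Finset.sum_le_sum (s := Finset.univ) fun x _ =>
    Finset.sum_le_sum (s := Finset.univ) fun y _ => key x y
  simp only [Finset.sum_sub_distrib, ← Finset.mul_sum, e1, e2, sum_ind] at hsum
  have hlt : ∑ x : V, ((covSet B (C ⊔ Submodule.span F {x})).card : ℝ) <
      ∑ x : V, q * w * N / D := by
    refine Finset.sum_lt_sum_of_nonempty ⟨0, Finset.mem_univ _⟩ fun x _ => ?_
    rw [lt_div_iff₀ hD]
    exact hcon x
  simp only [Finset.sum_const, Finset.card_univ, nsmul_eq_mul] at hlt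
  rw [← hN] at hlt
  have : 2 * (N / D) * (q * N * w) - (N / D) ^ 2 * (q * w * D) = N * (q * w * N / D) := by
    field_simp; ring
  linarith

theorem step2 {F V : Type*} [Field F] [Fintype F] [AddCommGroup V] [Module F V] [Fintype V]
    (B : Finset V) (C : Submodule F V) :
    ∃ x : V, (Fintype.card V - (covSet B (C ⊔ Submodule.span F {x})).card : ℝ) * Fintype.card V ≤
      (Fintype.card V - (covSet B C).card : ℝ) ^ 2 := by
  classical
  by_contra! hcon
  set W := covSet B C with hW
  set f : V → ℝ := fun y => 1 - if y ∈ W then 1 else 0 with hf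
  set N : ℝ := (Fintype.card V : ℝ) with hN
  have hfs : ∑ y, f y = N - W.card := by
    simp only [hf, Finset.sum_sub_distrib, sum_ind]
    simp [hN]
  have e := sum_pair f (0 : F) 1 zero_ne_one
  rw [hfs] at e
  have key : ∀ x y, (1 - if y ∈ covSet B (C ⊔ Submodule.span F {x}) then (1 : ℝ) else 0) ≤
      f (y - (0 : F) • x) * f (y - (1 : F) • x) := by
    intro x y
    have hp : ∀ y, 0 ≤ f y := by intro y; simp only [hf]; split_ifs <;> simp
    split_ifs with h
    · simpa using mul_nonneg (hp _) (hp _)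
    · have : ∀ a : F, f (y - a • x) = 1 := by
        intro a
        simp only [hf]
        rw [if_neg]; · simp
        intro h'
        exact h (covSet_sup B C x y a h')
      rw [this, this]; simp
  have hsum := Finset.sum_le_sum (s := Finset.univ) fun x _ =>
    Finset.sum_le_sum (s := Finset.univ) fun y _ => key x y
  rw [e] at hsum
  simp only [Finset.sum_sub_distrib, sum_ind] at hsum
  have hN0 : 0 < N := by
    rw [hN]; exact_mod_cast Fintype.card_pos
  have hlt : ∑ x : V, (N - W.card) ^ 2 / N <
      ∑ x : V, (N - ((covSet B (C ⊔ Submodule.span F {x})).card : ℝ)) := by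
    refine Finset.sum_lt_sum_of_nonempty ⟨0, Finset.mem_univ _⟩ fun x _ => ?_
    rw [div_lt_iff₀ hN0]
    exact hcon x
  simp only [Finset.sum_sub_distrib, Finset.sum_const, Finset.card_univ, nsmul_eq_mul] at hlt hsum
  rw [← hN] at hlt hsum
  have : N * ((N - W.card) ^ 2 / N) = (N - W.card) ^ 2 := by field_simp
  nlinarith

theorem finrank_sup_span {F V : Type*} [Field F] [AddCommGroup V] [Module F V]
    [FiniteDimensional F V] (C : Submodule F V) (x : V) :
    Module.finrank F (C ⊔ Submodule.span F {x} : Submodule F V) ≤ Module.finrank F C + 1 := by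
  have h1 := Submodule.finrank_add_le_finrank_add_finrank C (Submodule.span F {x})
  have h2 := finrank_span_le_card (R := F) ({x} : Set V)
  simp at h2
  omega

theorem card_cov_le {F V : Type*} [Field F] [AddCommGroup V] [Module F V] [Fintype V]
    (B : Finset V) (C : Submodule F V) : ((covSet B C).card : ℝ) ≤ Fintype.card V := by
  exact_mod_cast Finset.card_le_univ _

theorem phase1 {F V : Type*} [Field F] [Fintype F] [AddCommGroup V] [Module F V] [Fintype V]
    [FiniteDimensional F V] (B : Finset V) (hB : B.Nonempty) (k : ℕ) :
    ∃ C : Submodule F V, Module.finrank F C ≤ k ∧ 0 < ((covSet B C).card : ℝ) ∧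
      ((Fintype.card V : ℝ) / (covSet B C).card - 1) * (Fintype.card F : ℝ) ^ k ≤
        Fintype.card V / B.card := by
  classical
  induction k with
  | zero =>
    have : covSet B (⊥ : Submodule F V) = B := by
      ext y; simp [covSet]
    refine ⟨⊥, by simp, ?_, ?_⟩
    · rw [this]; exact_mod_cast hB.card_pos
    · rw [this]; simp
  | succ k ih =>
    obtain ⟨C, hC, hpos, hk⟩ := ih
    obtain ⟨x, hx⟩ := step1 B C
    have hmem := finrank_sup_span C x
    set q : ℝ := (Fintype.card F : ℝ) with hq
    set N : ℝ := (Fintype.card V : ℝ) with hN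
    have hN0 : 0 < N := by rw [hN]; exact_mod_cast Fintype.card_pos
    have hq1 : 1 ≤ q := by
      rw [hq]; exact_mod_cast Fintype.card_pos
    set w : ℝ := ((covSet B C).card : ℝ) with hw
    set w' : ℝ := ((covSet B (C ⊔ Submodule.span F {x})).card : ℝ) with hw'
    have hD : 0 < N + (q - 1) * w := by nlinarith
    have hw'0 : 0 < w' := by
      have : 0 < q * w * N := by positivity
      by_contra! h
      nlinarith
    refine ⟨C ⊔ Submodule.span F {x}, by omega, hw'0, ?_⟩
    have : (N / w' - 1) * q ≤ N / w - 1 := by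
      have h1 : N / w' * q ≤ N / w + (q - 1) := by
        rw [div_mul_eq_mul_div, div_add' _ _ _ hpos.ne', div_le_div_iff₀ hw'0 hpos]
        linarith
      linarith
    calc _ = ((N / w' - 1) * q) * q ^ k := by rw [pow_succ]; ring
      _ ≤ (N / w - 1) * q ^ k := by gcongr
      _ ≤ _ := hk

theorem phase2 {F V : Type*} [Field F] [Fintype F] [AddCommGroup V] [Module F V] [Fintype V]
    [FiniteDimensional F V] (B : Finset V) (C₀ : Submodule F V)
    (h : (Fintype.card V : ℝ) ≤ 2 * (covSet B C₀).card) (m : ℕ) :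
    ∃ C : Submodule F V, Module.finrank F C ≤ Module.finrank F C₀ + m ∧
      ((Fintype.card V : ℝ) - (covSet B C).card) * 2 ^ (2 ^ m) ≤ Fintype.card V := by
  induction m with
  | zero => exact ⟨C₀, by simp, by norm_num; linarith⟩
  | succ m ih =>
    obtain ⟨C, hC, hk⟩ := ih
    obtain ⟨x, hx⟩ := step2 B C
    have hmem := finrank_sup_span C x
    refine ⟨C ⊔ Submodule.span F {x}, by omega, ?_⟩
    have hle := card_cov_le B C
    set N : ℝ := (Fintype.card V : ℝ) with hN
    have hN0 : 0 < N := by rw [hN]; exact_mod_cast Fintype.card_pos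
    set u : ℝ := N - (covSet B C).card
    set u' : ℝ := N - (covSet B (C ⊔ Submodule.span F {x})).card
    have hu : 0 ≤ u := by simp only [u]; linarith
    have hsq : (u * 2 ^ 2 ^ m) ^ 2 ≤ N ^ 2 := by
      apply pow_le_pow_left₀ (by positivity) hk
    have : (2 : ℝ) ^ 2 ^ (m + 1) = (2 ^ 2 ^ m) ^ 2 := by rw [← pow_mul, pow_succ]
    rw [this]
    refine le_of_mul_le_mul_right ?_ hN0
    calc u' * (2 ^ 2 ^ m) ^ 2 * N = (u' * N) * (2 ^ 2 ^ m) ^ 2 := by ring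
      _ ≤ u ^ 2 * (2 ^ 2 ^ m) ^ 2 := by gcongr
      _ = (u * 2 ^ 2 ^ m) ^ 2 := by ring
      _ ≤ N * N := by rw [← sq]; exact hsq

theorem covering {F V : Type*} [Field F] [Fintype F] [AddCommGroup V] [Module F V] [Fintype V]
    [FiniteDimensional F V] (B : Finset V) (hB : B.Nonempty) (k m : ℕ)
    (hk : (Fintype.card V : ℝ) / B.card ≤ (Fintype.card F : ℝ) ^ k)
    (hm : Fintype.card V < 2 ^ 2 ^ m) :
    ∃ C : Submodule F V, Module.finrank F C ≤ k + m ∧ ∀ y, ∃ c ∈ C, y - c ∈ B := by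
  obtain ⟨C₀, h1, h2, h3⟩ := phase1 (F := F) B hB k
  have hqk : (0 : ℝ) < (Fintype.card F : ℝ) ^ k := by
    have : 0 < Fintype.card F := Fintype.card_pos
    positivity
  have h4 : (Fintype.card V : ℝ) / (covSet B C₀).card - 1 ≤ 1 := by
    by_contra! hc
    nlinarith
  have h5 : (Fintype.card V : ℝ) ≤ 2 * (covSet B C₀).card := by
    rw [← div_le_iff₀ h2]; linarith
  obtain ⟨C, h6, h7⟩ := phase2 B C₀ h5 m
  refine ⟨C, by omega, ?_⟩
  have hle : (covSet B C).card ≤ Fintype.card V := Finset.card_le_univ _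
  have h8 : (covSet B C).card = Fintype.card V := by
    by_contra hne
    have hlt : (covSet B C).card + 1 ≤ Fintype.card V := by omega
    have hlt' : ((covSet B C).card : ℝ) + 1 ≤ Fintype.card V := by exact_mod_cast hlt
    have hm' : (Fintype.card V : ℝ) < 2 ^ 2 ^ m := by exact_mod_cast hm
    have : (0 : ℝ) < 2 ^ 2 ^ m := by positivity
    nlinarith
  have h9 := (Finset.card_eq_iff_eq_univ _).1 h8
  intro y
  have : y ∈ covSet B C := by rw [h9]; exact Finset.mem_univ _
  simpa [covSet] using this

theorem log_fact_upper (n : ℕ) :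
    Real.log (n.factorial) ≤ n * Real.log n - n + Real.log n + 1 := by
  induction n with
  | zero => simp
  | succ n ih =>
    rcases Nat.eq_zero_or_pos n with h | h
    · subst h; simp
    · have hn : (0 : ℝ) < n := by exact_mod_cast h
      rw [Nat.factorial_succ]
      push_cast
      rw [Real.log_mul (by positivity) (by positivity)]
      have h1 := Real.one_sub_inv_le_log_of_pos (x := (n + 1 : ℝ) / n) (by positivity)
      rw [Real.log_div (by positivity) (by positivity)] at h1
      have h2 : (n + 1 : ℝ) * (1 - ((n + 1 : ℝ) / n)⁻¹) = 1 := by field_simp; ring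
      have h3 := mul_le_mul_of_nonneg_left h1 (show (0 : ℝ) ≤ n + 1 by positivity)
      rw [h2] at h3
      nlinarith

theorem log_fact_lower (n : ℕ) :
    n * Real.log n - n ≤ Real.log (n.factorial) := by
  induction n with
  | zero => simp
  | succ n ih =>
    rcases Nat.eq_zero_or_pos n with h | h
    · subst h; simp
    · have hn : (0 : ℝ) < n := by exact_mod_cast h
      rw [Nat.factorial_succ]
      push_cast
      rw [Real.log_mul (by positivity) (by positivity)]
      have h1 := Real.log_le_sub_one_of_pos (x := (n + 1 : ℝ) / n) (by positivity)
      rw [Real.log_div (by positivity) (by positivity)] at h1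
      have h2 : (n : ℝ) * ((n + 1 : ℝ) / n - 1) = 1 := by field_simp; ring
      have h3 := mul_le_mul_of_nonneg_left h1 hn.le
      rw [h2] at h3
      nlinarith

theorem log_choose_lower (n r : ℕ) (hn : 0 < n) (h : r ≤ n) :
    n * Real.binEntropy (r / n) - 2 * (Real.log n + 1) ≤ Real.log (n.choose r) := by
  obtain ⟨s, rfl⟩ := Nat.exists_eq_add_of_le h
  rw [Nat.choose_symm_add, Nat.add_choose]
  rw [Nat.cast_div (Nat.factorial_mul_factorial_dvd_factorial_add r s) (by positivity)]
  push_cast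
  rw [Real.log_div (by positivity) (by positivity), Real.log_mul (by positivity) (by positivity)]
  have h1 := log_fact_lower (r + s)
  have h2 := log_fact_upper r
  have h3 := log_fact_upper s
  have hn' : (0 : ℝ) < r + s := by exact_mod_cast hn
  have hlog : ∀ a : ℕ, a ≤ r + s → Real.log a ≤ Real.log (r + s) := by
    intro a ha
    rcases Nat.eq_zero_or_pos a with h | h
    · subst h; simp
      exact_mod_cast Real.log_natCast_nonneg (r + s)
    · apply Real.log_le_log (by exact_mod_cast h) (by exact_mod_cast ha)
  have h4 := hlog r (by omega)
  have h5 := hlog s (by omega)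
  have hsub : (1 : ℝ) - r / (r + s) = s / (r + s) := by field_simp; ring
  have hmul : ∀ a : ℕ, (r + s : ℝ) * (a / (r + s) * Real.log (a / (r + s))) =
      a * Real.log a - a * Real.log (r + s) := by
    intro a
    rcases Nat.eq_zero_or_pos a with h | h
    · subst h; simp
    · rw [Real.log_div (by positivity) (by positivity)]
      field_simp
  have hb : (r + s : ℝ) * Real.binEntropy (r / (r + s)) =
      (r + s) * Real.log (r + s) - r * Real.log r - s * Real.log s := by
    rw [Real.binEntropy, hsub, Real.log_inv, Real.log_inv]
    have := hmul r
    have := hmul s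
    linarith
  push_cast at *
  rw [hb]
  linarith

theorem ball_lower {F : Type*} [Field F] [Fintype F] [DecidableEq F] (n r : ℕ) :
    n.choose r * (Fintype.card F - 1) ^ r ≤
      (Finset.univ.filter (fun v : Fin n → F => (Finset.univ.filter (fun i => v i ≠ 0)).card ≤ r)).card := by
  classical
  let P : Finset (Fin n) → Finset (Fin n → F) := fun S =>
    Fintype.piFinset (fun i => if i ∈ S then Finset.univ.erase 0 else {0})
  have hP : ∀ S v, v ∈ P S → Finset.univ.filter (fun i => v i ≠ 0) = S := by
    intro S v hv
    simp only [P, Fintype.mem_piFinset] at hv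
    ext i
    have := hv i
    split_ifs at this with h <;> simp_all
  have hcard : ∀ S, (P S).card = (Fintype.card F - 1) ^ S.card := by
    intro S
    simp only [P, Fintype.card_piFinset]
    have : ∀ i, (if i ∈ S then (Finset.univ : Finset F).erase 0 else {0}).card =
        if i ∈ S then (Fintype.card F - 1) else 1 := by
      intro i; split_ifs <;> simp [Finset.card_erase_of_mem]
    simp only [this, Finset.prod_ite_mem, Finset.univ_inter, Finset.prod_const]
  have hu : ((Finset.univ.powersetCard r).biUnion P).card = n.choose r * (Fintype.card F - 1) ^ r := by
    rw [Finset.card_biUnion]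
    · rw [Finset.sum_congr rfl (g := fun _ => (Fintype.card F - 1) ^ r)]
      · simp
      · intro S hS
        rw [hcard, (Finset.mem_powersetCard.1 hS).2]
    · intro S _ T _ hST
      refine Finset.disjoint_left.2 ?_
      intro v h1 h2
      exact hST ((hP S v h1).symm.trans (hP T v h2))
  rw [← hu]
  apply Finset.card_le_card
  intro v hv
  obtain ⟨S, hS, hv⟩ := Finset.mem_biUnion.1 hv
  rw [Finset.mem_filter, hP S v hv]
  exact ⟨Finset.mem_univ _, (Finset.mem_powersetCard.1 hS).2.le⟩

theorem twt_le {F : Type*} [Field F] [DecidableEq F] {t n r : ℕ} (v : Matrix (Fin t) (Fin n) F)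
    (h : ∀ i, (Finset.univ.filter (fun j => v i j ≠ 0)).card ≤ r) : twt v ≤ t * r := by
  classical
  have : {j : Fin n | ∃ i : Fin t, v i j ≠ 0} =
      ((Finset.univ.biUnion fun i : Fin t => Finset.univ.filter (fun j => v i j ≠ 0) : Finset (Fin n)) : Set (Fin n)) := by
    ext j; simp
  rw [twt, this, Set.ncard_coe_finset]
  have := Finset.card_biUnion_le_card_mul Finset.univ
    (fun i : Fin t => Finset.univ.filter (fun j => v i j ≠ 0)) r (fun i _ => h i)
  simpa using this

theorem kMin_le {F : Type*} [Field F] [Fintype F] (t n r R : ℕ) (hr : t * r ≤ R) (hrn : r ≤ n)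
    (hn : 0 < n) :
    (kMin F t n R : ℝ) ≤ 1 + n - Real.logb (Fintype.card F) (n.choose r * (Fintype.card F - 1) ^ r)
      + Nat.clog 2 (Fintype.card F * n) := by
  classical
  set q := Fintype.card F with hq
  have hq2 : 2 ≤ q := Fintype.one_lt_card
  have hq1 : (1 : ℝ) < q := by exact_mod_cast hq2
  set B : Finset (Fin n → F) :=
    Finset.univ.filter (fun v : Fin n → F => (Finset.univ.filter (fun i => v i ≠ 0)).card ≤ r) with hB
  have hBl := ball_lower (F := F) n r
  rw [← hB, ← hq] at hBl
  have hBl' : (n.choose r * (q - 1) ^ r : ℝ) ≤ B.card := by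
    have : ((n.choose r * (q - 1) ^ r : ℕ) : ℝ) ≤ B.card := by exact_mod_cast hBl
    rw [Nat.cast_mul, Nat.cast_pow, Nat.cast_sub (by omega)] at this
    simpa using this
  have hpos : (0 : ℝ) < n.choose r * (q - 1) ^ r := by
    have := Nat.choose_pos hrn
    have : (0 : ℝ) < q - 1 := by linarith
    positivity
  have hB0 : (0 : ℝ) < B.card := hpos.trans_le hBl'
  have hBne : B.Nonempty := Finset.card_pos.1 (by exact_mod_cast hB0)
  have hV : Fintype.card (Fin n → F) = q ^ n := by simp [hq]
  have hVr : (Fintype.card (Fin n → F) : ℝ) = (q : ℝ) ^ n := by rw [hV]; push_cast; rfl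
  have hBle : (B.card : ℝ) ≤ (q : ℝ) ^ n := by
    rw [← hVr]; exact_mod_cast Finset.card_le_univ _
  set L := Real.logb q ((q : ℝ) ^ n / B.card) with hL
  have hL0 : 0 ≤ L := Real.logb_nonneg hq1 (by rw [le_div_iff₀ hB0]; linarith)
  have hk : (Fintype.card (Fin n → F) : ℝ) / B.card ≤ (Fintype.card F : ℝ) ^ ⌈L⌉₊ := by
    rw [hVr, ← hq, ← Real.rpow_natCast _ ⌈L⌉₊, ← Real.logb_le_iff_le_rpow hq1 (by positivity)]
    exact Nat.le_ceil _
  have hm : Fintype.card (Fin n → F) < 2 ^ 2 ^ (Nat.clog 2 (q * n)) := by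
    rw [hV]
    calc q ^ n < (2 ^ q) ^ n := Nat.pow_lt_pow_left Nat.lt_two_pow_self (by omega)
      _ = 2 ^ (q * n) := by rw [pow_mul]
      _ ≤ _ := Nat.pow_le_pow_right (by norm_num) (Nat.le_pow_clog (by norm_num) _)
  obtain ⟨C, hC, hcov⟩ := covering (F := F) B hBne ⌈L⌉₊ _ hk hm
  have h1 : kMin F t n R ≤ ⌈L⌉₊ + Nat.clog 2 (q * n) := by
    refine le_trans (Nat.sInf_le ⟨C, rfl, ?_⟩) hC
    apply Nat.sInf_le
    intro v
    choose c hc hcB using fun i => hcov (v i)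
    refine ⟨c, hc, ?_⟩
    change twt (_ : Matrix (Fin t) (Fin n) F) ≤ R
    refine (twt_le (r := r) _ fun i => ?_).trans hr
    have := hcB i
    rw [hB, Finset.mem_filter] at this
    exact this.2
  have h2 : (kMin F t n R : ℝ) ≤ ⌈L⌉₊ + Nat.clog 2 (q * n) := by exact_mod_cast h1
  have h3 := Nat.ceil_lt_add_one hL0
  have h4 : L = n - Real.logb q B.card := by
    rw [hL, Real.logb_div (by positivity) hB0.ne', Real.logb_pow, Real.logb_self_eq_one hq1]; ring
  have h5 := Real.logb_le_logb_of_le hq1 hpos hBl'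
  linarith

theorem tendsto_log_div : Filter.Tendsto (fun n : ℕ => Real.log n / n) Filter.atTop (nhds 0) :=
  (Real.isLittleO_log_id_atTop.tendsto_div_nhds_zero).comp tendsto_natCast_atTop_atTop

theorem stmt8 {F : Type*} [Field F] [Fintype F] {t : ℕ} (ht : 2 ≤ t) {ρ : ℝ}
    (h0 : 0 ≤ ρ) (h1 : ρ ≤ 1) :
    kappa F t ρ ≤ 1 - qEnt (Fintype.card F) (ρ / t) := by
  set q := Fintype.card F with hq
  have hq2 : 2 ≤ q := Fintype.one_lt_card
  have hq1 : (1 : ℝ) < q := by exact_mod_cast hq2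
  have hlq : 0 < Real.log q := Real.log_pos hq1
  have ht0 : (0 : ℝ) < t := by positivity
  have hx0 : 0 ≤ ρ / t := by positivity
  have hx1 : ρ / t ≤ 1 := by
    rw [div_le_one ht0]
    have : (2 : ℝ) ≤ t := by exact_mod_cast ht
    linarith
  set x := ρ / t with hx
  let y : ℕ → ℝ := fun n => (⌊x * n⌋₊ : ℝ) / n
  have hy : Filter.Tendsto y Filter.atTop (nhds x) :=
    (tendsto_nat_floor_mul_div_atTop (R := ℝ) hx0).comp tendsto_natCast_atTop_atTop
  have hinv : Filter.Tendsto (fun n : ℕ => (1 : ℝ) / n) Filter.atTop (nhds 0) :=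
    tendsto_one_div_atTop_nhds_zero_nat
  have hlog2 : 0 < Real.log 2 := Real.log_pos (by norm_num)
  let g : ℕ → ℝ := fun n => 1 / n + 1 - (Real.binEntropy (y n) / Real.log q
      - 2 * (Real.log n / n + 1 / n) / Real.log q + y n * Real.logb q (q - 1))
      + ((Real.log q / Real.log 2 + 1) * (1 / n) + (Real.log n / n) / Real.log 2)
  have hg : Filter.Tendsto g Filter.atTop (nhds (1 - qEnt q x)) := by
    have hb := (Real.binEntropy_continuous.tendsto x).comp hy
    have hl := tendsto_log_div
    have := ((hinv.add_const 1).sub (((hb.div_const (Real.log q)).sub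
      (((hl.add hinv).const_mul 2).div_const (Real.log q))).add
      (hy.mul_const (Real.logb q (q - 1))))).add
      ((hinv.const_mul (Real.log q / Real.log 2 + 1)).add (hl.div_const (Real.log 2)))
    refine this.congr' ?_ |>.trans_eq ?_
    · exact Filter.EventuallyEq.rfl
    · congr 1
      rw [qEnt, Real.binEntropy, Real.log_inv, Real.log_inv, Real.logb, Real.logb, Real.logb]
      field_simp; ring
  have hle : ∀ᶠ n : ℕ in Filter.atTop, (kMin F t n ⌊ρ * n⌋₊ : ℝ) / n ≤ g n := by
    filter_upwards [Filter.eventually_gt_atTop 0] with n hn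
    have hn' : (0 : ℝ) < n := by exact_mod_cast hn
    set r := ⌊x * n⌋₊ with hr
    have hfl : (r : ℝ) ≤ x * n := Nat.floor_le (by positivity)
    have hr1 : t * r ≤ ⌊ρ * n⌋₊ := by
      apply Nat.le_floor
      push_cast
      calc (t : ℝ) * r ≤ t * (x * n) := by gcongr
        _ = ρ * n := by rw [hx]; field_simp
    have hr2 : r ≤ n := by
      have : (r : ℝ) ≤ n := hfl.trans (by nlinarith)
      exact_mod_cast this
    have h := kMin_le (F := F) t n r _ hr1 hr2 hn
    rw [← hq] at h
    have hch := log_choose_lower n r hn hr2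
    have hqq : (0 : ℝ) < q - 1 := by linarith
    have hcp : (0 : ℝ) < n.choose r := by exact_mod_cast Nat.choose_pos hr2
    rw [Real.logb_mul hcp.ne' (by positivity), Real.logb_pow] at h
    have hch2 : _ ≤ Real.logb q (n.choose r) := div_le_div_of_nonneg_right hch hlq.le
    have hclog : (Nat.clog 2 (q * n) : ℝ) ≤ (Real.log q + Real.log n) / Real.log 2 + 1 := by
      have h2 : 1 < q * n := by nlinarith
      have h3 := Nat.pow_pred_clog_lt_self (b := 2) (by norm_num) h2
      have h4 : ((2 ^ (Nat.clog 2 (q * n)).pred : ℕ) : ℝ) ≤ (q * n : ℕ) := by exact_mod_cast h3.le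
      push_cast at h4
      have h5 := Real.log_le_log (by positivity) h4
      rw [Real.log_pow, Real.log_mul (by positivity) (by positivity), ← le_div_iff₀ hlog2] at h5
      have h6 : (Nat.clog 2 (q * n) : ℝ) ≤ ((Nat.clog 2 (q * n)).pred : ℝ) + 1 := by
        have : Nat.clog 2 (q * n) ≤ (Nat.clog 2 (q * n)).pred + 1 := by
          rw [Nat.pred_eq_sub_one]; omega
        exact_mod_cast this
      linarith
    rw [div_le_iff₀ hn']
    have hgn : g n * n = 1 + n - ((n * Real.binEntropy (r / n) - 2 * (Real.log n + 1)) / Real.log q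
        + r * Real.logb q (q - 1)) + ((Real.log q + Real.log n) / Real.log 2 + 1) := by
      simp only [g, y, ← hr]
      field_simp
      ring
    rw [hgn]
    linarith
  rw [kappa, ← hg.liminf_eq]
  refine Filter.liminf_le_liminf hle ?_ ?_
  · exact Filter.isBoundedUnder_of ⟨0, fun n => by positivity⟩
  · exact hg.isCoboundedUnder_ge
end
end

section
/- Let C_1 be an [n,k_1] linear code and C_2 an [n,k_2] linear code, both over F_q, and let C = {(u, u+v) : u ∈ C_1, v ∈ C_2} ⊆ F_q^{2n} be the code obtained by the (u, u+v) construction. Then for every t ≥ 1, R_t(C) ≤ R_t(C_1) + R_t(C_2). -/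
noncomputable section

theorem genCovRad_spec {F : Type*} [Field F] {n : ℕ} (C : Submodule F (Fin n → F)) (t : ℕ)
    (v : Matrix (Fin t) (Fin n) F) :
    ∃ c : Matrix (Fin t) (Fin n) F, (∀ i, c i ∈ (C : Set (Fin n → F))) ∧
      v ∈ tBall (genCovRad (C : Set (Fin n → F)) t) c := by
  have hne : {r : ℕ | ∀ v : Matrix (Fin t) (Fin n) F,
    ∃ c : Matrix (Fin t) (Fin n) F, (∀ i, c i ∈ (C : Set (Fin n → F))) ∧ v ∈ tBall r c}.Nonempty := by
    refine ⟨n, fun v => ⟨0, fun i => C.zero_mem, ?_⟩⟩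
    show Set.ncard _ ≤ n
    refine (Set.ncard_le_ncard (Set.subset_univ _) Set.finite_univ).trans ?_
    simp [Set.ncard_univ]
  exact Nat.sInf_mem hne v

theorem stmt16 {F : Type*} [Field F] [Fintype F] {n k₁ k₂ : ℕ}
    (C₁ C₂ : Submodule F (Fin n → F))
    (h₁ : Module.finrank F C₁ = k₁) (h₂ : Module.finrank F C₂ = k₂)
    {t : ℕ} (ht : 1 ≤ t) :
    genCovRad {w : Fin (n + n) → F | ∃ u ∈ C₁, ∃ v ∈ C₂, w = Fin.append u (u + v)} t
      ≤ genCovRad (C₁ : Set (Fin n → F)) t + genCovRad (C₂ : Set (Fin n → F)) t := by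
  refine Nat.sInf_le ?_
  intro v
  obtain ⟨c₁, hc₁, hb₁⟩ := genCovRad_spec C₁ t (fun i j => v i (Fin.castAdd n j))
  obtain ⟨c₂, hc₂, hb₂⟩ := genCovRad_spec C₂ t (fun i j => v i (Fin.natAdd n j) - c₁ i j)
  refine ⟨fun i => Fin.append (c₁ i) (c₁ i + c₂ i),
    fun i => ⟨c₁ i, hc₁ i, c₂ i, hc₂ i, rfl⟩, ?_⟩
  refine le_trans ?_ (Nat.add_le_add hb₁ hb₂)
  unfold twt
  rw [← Set.ncard_image_of_injective _ (Fin.castAdd_injective n n),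
    ← Set.ncard_image_of_injective (f := Fin.natAdd n) _ (Fin.natAdd_injective n n)]
  refine le_trans (Set.ncard_le_ncard ?_ (Set.toFinite _)) (Set.ncard_union_le _ _)
  rintro j ⟨i, hi⟩
  induction j using Fin.addCases with
  | left j =>
    left
    refine ⟨j, ⟨i, ?_⟩, rfl⟩
    change v i (Fin.castAdd n j) - Fin.append (c₁ i) (c₁ i + c₂ i) (Fin.castAdd n j) ≠ 0 at hi
    rw [Fin.append_left] at hi
    exact hi
  | right j =>
    right
    refine ⟨j, ⟨i, ?_⟩, rfl⟩
    change v i (Fin.natAdd n j) - Fin.append (c₁ i) (c₁ i + c₂ i) (Fin.natAdd n j) ≠ 0 at hi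
    rw [Fin.append_right, Pi.add_apply, ← sub_sub] at hi
    exact hi
end
end
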